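/- Let f : {0,1}^n → {0,1} be a non-constant Boolean function, let k_1 be the largest size of a prime implicant of f and k_2 the largest size of a prime implicate of f. Then cc_u^{(1)}(f̃) = k_1, cc_u^{(0)}(f̃) = k_2, and cc_u^{(u)}(f̃) ≤ k_1 + k_2 − 1. -/

import Mathlib

/-- Kleene's three-valued domain: `none` is the unstable value `u`,
`some b` is a stable Boolean value. -/
abbrev K : Type := Option Bool

namespace HF

variable {ι : Type} [Fintype ι] [DecidableEq ι]

/-- Instability order on inputs: `Below x y` means `x ≤ y`, i.e. each coordinate of `x`
is either `u` or equal to the corresponding coordinate of `y`. -/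
def Below (x y : ι → K) : Prop := ∀ i, x i = none ∨ x i = y i

/-- `x` is strictly below `y` in the instability order. -/
def StrictBelow (x y : ι → K) : Prop := Below x y ∧ x ≠ y

/-- `y` is strictly above `x` in the instability order. -/
def StrictAbove (y x : ι → K) : Prop := Below x y ∧ y ≠ x

/-- `x : ι → Bool` is a resolution of `y : ι → K`. -/
def Resolves (y : ι → K) (x : ι → Bool) : Prop := ∀ i, y i = none ∨ y i = some (x i)

instance (y : ι → K) : DecidablePred (Resolves y) := fun x => by
  unfold Resolves; infer_instance

/-- The hazard-free extension of a Boolean function `f`. -/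
def hfExt (f : (ι → Bool) → Bool) (y : ι → K) : K :=
  if ∀ x, Resolves y x → f x = true then some true
  else if ∀ x, Resolves y x → f x = false then some false
  else none

/-- Number of unstable (`u`) coordinates of an input. -/
def numU (x : ι → K) : ℕ := (Finset.univ.filter fun i => x i = none).card

/-- Ternary (hazard-free) decision trees: leaves are labeled by values in `K`,
internal nodes query a position and have children for responses `0`, `u`, `1`. -/
inductive TDT (ι : Type) : Type where
  | leaf : K → TDT ι
  | node : ι → TDT ι → TDT ι → TDT ι → TDT ι

namespace TDT

/-- Evaluate a ternary decision tree on an input in `K^ι`. -/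
def eval : TDT ι → (ι → K) → K
  | .leaf b, _ => b
  | .node i t0 tu t1, x =>
    match x i with
    | some false => eval t0 x
    | none => eval tu x
    | some true => eval t1 x

/-- Depth of a ternary decision tree. -/
def depth : TDT ι → ℕ
  | .leaf _ => 0
  | .node _ t0 tu t1 => max (max (depth t0) (depth tu)) (depth t1) + 1

/-- Size (number of leaves) of a ternary decision tree. -/
def size : TDT ι → ℕ
  | .leaf _ => 1
  | .node _ t0 tu t1 => size t0 + size tu + size t1

end TDT

/-- Boolean decision trees. -/
inductive BDT (ι : Type) : Type where
  | leaf : Bool → BDT ι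
  | node : ι → BDT ι → BDT ι → BDT ι

namespace BDT

/-- Evaluate a Boolean decision tree. -/
def eval : BDT ι → (ι → Bool) → Bool
  | .leaf b, _ => b
  | .node i t0 t1, x => if x i then eval t1 x else eval t0 x

/-- Depth of a Boolean decision tree. -/
def depth : BDT ι → ℕ
  | .leaf _ => 0
  | .node _ t0 t1 => max (depth t0) (depth t1) + 1

/-- Size (number of leaves) of a Boolean decision tree. -/
def size : BDT ι → ℕ
  | .leaf _ => 1
  | .node _ t0 t1 => size t0 + size t1

end BDT

/-- A ternary tree computes (the hazard-free extension of) the Boolean function `f`. -/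
def ComputesHF (f : (ι → Bool) → Bool) (T : TDT ι) : Prop := ∀ x, T.eval x = hfExt f x

/-- A ternary tree computes a `K`-valued function `g`. -/
def ComputesT (g : (ι → K) → K) (T : TDT ι) : Prop := ∀ x, T.eval x = g x

/-- A Boolean tree computes the Boolean function `f`. -/
def ComputesB (f : (ι → Bool) → Bool) (T : BDT ι) : Prop := ∀ x, T.eval x = f x

/-- A `k`-bit hazard-free decision tree for `f`: correct on all inputs with at most
`k` unstable coordinates. -/
def KComputes (k : ℕ) (f : (ι → Bool) → Bool) (T : TDT ι) : Prop :=
  ∀ x : ι → K, numU x ≤ k → T.eval x = hfExt f x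

/-- Minimum depth of a ternary decision tree computing a `K`-valued function. -/
noncomputable def depthT (g : (ι → K) → K) : ℕ :=
  sInf {d | ∃ T : TDT ι, ComputesT g T ∧ T.depth = d}

/-- Hazard-free decision tree depth of a Boolean function. -/
noncomputable def depthU (f : (ι → Bool) → Bool) : ℕ :=
  sInf {d | ∃ T : TDT ι, ComputesHF f T ∧ T.depth = d}

/-- Hazard-free decision tree size (minimum number of leaves). -/
noncomputable def sizeU (f : (ι → Bool) → Bool) : ℕ :=
  sInf {s | ∃ T : TDT ι, ComputesHF f T ∧ T.size = s}

/-- Boolean decision tree size (minimum number of leaves). -/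
noncomputable def sizeB (f : (ι → Bool) → Bool) : ℕ :=
  sInf {s | ∃ T : BDT ι, ComputesB f T ∧ T.size = s}

/-- The multiplexer function `MUX n` on `n` selector bits and `2^n` data bits. -/
def MUX (n : ℕ) (z : (Fin n ⊕ (Fin n → Bool)) → Bool) : Bool :=
  z (Sum.inr fun i => z (Sum.inl i))

/-- Hazard-free sensitivity of `g` at `x`. -/
noncomputable def sensAt (g : (ι → K) → K) (x : ι → K) : ℕ :=
  Set.ncard {i : ι | ∃ y : ι → K, y i ≠ x i ∧ (∀ j, j ≠ i → y j = x j) ∧ g y ≠ g x}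

/-- Hazard-free sensitivity of `g`. -/
noncomputable def sens (g : (ι → K) → K) : ℕ := ⨆ x : ι → K, sensAt g x

/-- Hazard-free sensitivity of `g` restricted to inputs with output value `b`. -/
noncomputable def sensVal (g : (ι → K) → K) (b : K) : ℕ :=
  ⨆ x : {x : ι → K // g x = b}, sensAt g x.1

/-- Hazard-free block sensitivity of `g` at `x`. -/
noncomputable def bsensAt (g : (ι → K) → K) (x : ι → K) : ℕ :=
  sSup {k : ℕ | ∃ B : Fin k → Finset ι, (∀ j, (B j).Nonempty) ∧
    (∀ j j', j ≠ j' → Disjoint (B j) (B j')) ∧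
    ∀ j, ∃ y : ι → K, (∀ i, y i ≠ x i ↔ i ∈ B j) ∧ g y ≠ g x}

/-- Hazard-free block sensitivity of `g`. -/
noncomputable def bsens (g : (ι → K) → K) : ℕ := ⨆ x, bsensAt g x

/-- Hazard-free certificate complexity of `g` at `x`. -/
noncomputable def ccAt (g : (ι → K) → K) (x : ι → K) : ℕ :=
  sInf {k : ℕ | ∃ S : Finset ι, S.card = k ∧
    ∀ y : ι → K, (∀ i ∈ S, y i = x i) → g y = g x}

/-- Hazard-free certificate complexity of `g`. -/
noncomputable def cc (g : (ι → K) → K) : ℕ := ⨆ x, ccAt g x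

/-- Hazard-free certificate complexity of `g` restricted to inputs with output value `b`. -/
noncomputable def ccVal (g : (ι → K) → K) (b : K) : ℕ :=
  ⨆ x : {x : ι → K // g x = b}, ccAt g x.1

/-- Boolean sensitivity of a Boolean function. -/
noncomputable def boolSens (f : (ι → Bool) → Bool) : ℕ :=
  ⨆ x : ι → Bool, Set.ncard {i : ι | f (Function.update x i (!(x i))) ≠ f x}

/-- `p` is a prime implicant of `f`. -/
def PrimeImplicant (f : (ι → Bool) → Bool) (p : ι → K) : Prop :=
  hfExt f p = some true ∧ ∀ q, StrictBelow q p → hfExt f q ≠ some true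

/-- `p` is a prime implicate of `f`. -/
def PrimeImplicate (f : (ι → Bool) → Bool) (p : ι → K) : Prop :=
  hfExt f p = some false ∧ ∀ q, StrictBelow q p → hfExt f q ≠ some false

/-- Size of an implicant/implicate: the number of stable coordinates. -/
noncomputable def isize (p : ι → K) : ℕ := Set.ncard {i : ι | p i ≠ none}

/-- Hamming distance between two inputs in `K^ι`. -/
noncomputable def hamm (x y : ι → K) : ℕ := Set.ncard {i : ι | x i ≠ y i}

/-- Hazard-free evaluation of a literal (variable and polarity). -/
def litEval (x : ι → K) (l : ι × Bool) : K := if l.2 then x l.1 else (x l.1).map not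

/-- Hazard-free evaluation of a term (conjunction of literals). -/
def termEval (t : Finset (ι × Bool)) (x : ι → K) : K :=
  if ∀ l ∈ t, litEval x l = some true then some true
  else if ∃ l ∈ t, litEval x l = some false then some false
  else none

/-- Hazard-free evaluation of a clause (disjunction of literals). -/
def clauseEval (c : Finset (ι × Bool)) (x : ι → K) : K :=
  if ∃ l ∈ c, litEval x l = some true then some true
  else if ∀ l ∈ c, litEval x l = some false then some false
  else none

/-- Hazard-free evaluation of a DNF formula (a set of terms). -/
def dnfEval (D : Finset (Finset (ι × Bool))) (x : ι → K) : K :=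
  if ∃ t ∈ D, termEval t x = some true then some true
  else if ∀ t ∈ D, termEval t x = some false then some false
  else none

/-- Hazard-free evaluation of a CNF formula (a set of clauses). -/
def cnfEval (C : Finset (Finset (ι × Bool))) (x : ι → K) : K :=
  if ∀ c ∈ C, clauseEval c x = some true then some true
  else if ∃ c ∈ C, clauseEval c x = some false then some false
  else none

/-- A function `g : K^ι → K` is weakly hazard-free: it is monotone with respect to the
instability order, and whenever all points strictly above `x` have the same value `b`
(and some such point exists), `g x = b` as well. -/
def WeaklyHF (g : (ι → K) → K) : Prop :=
  (∀ x y, Below x y → g x = none ∨ g x = g y) ∧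
  (∀ x (b : K), (∃ y, StrictAbove y x) → (∀ y, StrictAbove y x → g y = b) → g x = b)

/-- The subcube `C(x)` is monochromatic for `f`. -/
def Mono (f : (ι → Bool) → Bool) (x : ι → K) : Prop :=
  ∀ y z : ι → Bool, Resolves x y → Resolves x z → f y = f z

/-- The subcube `C(x)` is colorful for `f` (contains both a 0-point and a 1-point). -/
def Colorful (f : (ι → Bool) → Bool) (x : ι → K) : Prop :=
  ∃ y z : ι → Bool, Resolves x y ∧ Resolves x z ∧ f y ≠ f z

/-- `C(x)` is a minimal colorful cube for `f`. -/
def MinColorful (f : (ι → Bool) → Bool) (x : ι → K) : Prop :=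
  Colorful f x ∧ ∀ i, x i = none →
    (Mono f (Function.update x i (some false)) ∨ Mono f (Function.update x i (some true)))

/-- A Boolean function is non-degenerate if it depends on every input position. -/
def Nondegenerate (f : (ι → Bool) → Bool) : Prop :=
  ∀ i : ι, ∃ x y : ι → Bool, (∀ j, j ≠ i → x j = y j) ∧ x i ≠ y i ∧ f x ≠ f y

/-- The `n`-input AND function. -/
def ANDf (n : ℕ) (x : Fin n → Bool) : Bool := decide (∀ i, x i = true)

set_option linter.unusedSectionVars false

/-- The set of stable coordinates of a point. -/
def stableSet (p : ι → K) : Finset ι := Finset.univ.filter fun i => p i ≠ none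

theorem mem_stableSet {p : ι → K} {i : ι} : i ∈ stableSet p ↔ p i ≠ none := by
  simp [stableSet]

theorem isize_eq_card_stableSet (p : ι → K) : isize p = (stableSet p).card := by
  rw [isize, Set.ncard_eq_toFinset_card', stableSet, Set.toFinset_ofPred]

/-- `p` is minimal in the instability order among the points where `hfExt f` is `some b`. -/
def PrimePoint (f : (ι → Bool) → Bool) (b : Bool) (p : ι → K) : Prop :=
  hfExt f p = some b ∧ ∀ q, StrictBelow q p → hfExt f q ≠ some b

theorem exists_resolves (y : ι → K) : ∃ x, Resolves y x :=
  ⟨fun i => (y i).getD false, fun i => by cases h : y i <;> simp [h]⟩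

theorem hfExt_eq_some_iff (f : (ι → Bool) → Bool) (y : ι → K) (b : Bool) :
    hfExt f y = some b ↔ ∀ x, Resolves y x → f x = b := by
  obtain ⟨x₀, hx₀⟩ := exists_resolves y
  unfold hfExt
  split_ifs with ht hf
  · have := ht x₀ hx₀
    cases b
    · simpa using ⟨x₀, hx₀, this⟩
    · simpa using ht
  · cases b
    · simpa using hf
    · simpa using ht
  · cases b
    · simpa using hf
    · simpa using ht

theorem hfExt_eq_none_iff (f : (ι → Bool) → Bool) (y : ι → K) :
    hfExt f y = none ↔ ∀ b, ∃ x, Resolves y x ∧ f x = b := by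
  have key : ∀ b, hfExt f y ≠ some (!b) ↔ ∃ x, Resolves y x ∧ f x = b := fun b => by
    rw [Ne, hfExt_eq_some_iff]
    push Not
    simp
  simp_rw [← key]
  cases hfExt f y with
  | none => simp
  | some c => cases c <;> simp

theorem Resolves.of_below {x y : ι → K} (h : Below x y) {z : ι → Bool} (hz : Resolves y z) :
    Resolves x z := fun i => by
  rcases h i with h | h
  · exact Or.inl h
  · rw [h]; exact hz i

theorem hfExt_eq_some_of_below {f : (ι → Bool) → Bool} {x y : ι → K} {b : Bool}
    (h : Below x y) (hx : hfExt f x = some b) : hfExt f y = some b := by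
  rw [hfExt_eq_some_iff] at hx ⊢
  exact fun z hz => hx z (hz.of_below h)

theorem Below.trans {x y z : ι → K} (h : Below x y) (h' : Below y z) : Below x z := fun i => by
  rcases h i with h | h
  · exact Or.inl h
  · rw [h]; exact h' i

theorem stableSet_ssubset_of_strictBelow {q p : ι → K} (h : StrictBelow q p) :
    stableSet q ⊂ stableSet p := by
  obtain ⟨hb, hne⟩ := h
  rw [Finset.ssubset_iff_subset_ne]
  refine ⟨fun i hi => ?_, fun he => hne ?_⟩
  · rw [mem_stableSet] at hi ⊢
    rcases hb i with h | h
    · exact absurd h hi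
    · rwa [← h]
  · funext i
    rcases hb i with h | h
    · have : i ∉ stableSet p := by rw [← he, mem_stableSet]; simpa using h
      rw [mem_stableSet, not_not] at this
      rw [h, this]
    · exact h

theorem exists_primePoint_below {f : (ι → Bool) → Bool} {b : Bool} {x : ι → K}
    (hx : hfExt f x = some b) : ∃ p, PrimePoint f b p ∧ Below p x := by
  induction hn : (stableSet x).card using Nat.strong_induction_on generalizing x with
  | _ m ih =>
    by_cases h : ∃ q, StrictBelow q x ∧ hfExt f q = some b
    · obtain ⟨q, hq, hfq⟩ := h
      obtain ⟨p, hp, hpq⟩ := ih _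
        (hn ▸ Finset.card_lt_card (stableSet_ssubset_of_strictBelow hq)) hfq rfl
      exact ⟨p, hp, hpq.trans hq.1⟩
    · push Not at h
      exact ⟨x, ⟨hx, h⟩, fun i => Or.inr rfl⟩

theorem ccAt_le_card {g : (ι → K) → K} {x : ι → K} {S : Finset ι}
    (h : ∀ y : ι → K, (∀ i ∈ S, y i = x i) → g y = g x) : ccAt g x ≤ S.card :=
  Nat.sInf_le ⟨S, rfl, h⟩

theorem exists_certificate_card_eq_ccAt (g : (ι → K) → K) (x : ι → K) :
    ∃ S : Finset ι, S.card = ccAt g x ∧ ∀ y : ι → K, (∀ i ∈ S, y i = x i) → g y = g x :=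
  Nat.sInf_mem (s := {k : ℕ | ∃ S : Finset ι, S.card = k ∧
    ∀ y : ι → K, (∀ i ∈ S, y i = x i) → g y = g x})
    ⟨_, Finset.univ, rfl, fun _ hy => congrArg g (funext fun i => hy i (Finset.mem_univ i))⟩

theorem ccAt_le_isize_of_below {f : (ι → Bool) → Bool} {b : Bool} {p x : ι → K}
    (hp : hfExt f p = some b) (h : Below p x) : ccAt (hfExt f) x ≤ isize p := by
  rw [isize_eq_card_stableSet]
  refine ccAt_le_card fun y hy => ?_
  rw [hfExt_eq_some_of_below h hp]
  refine hfExt_eq_some_of_below (fun i => ?_) hp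
  by_cases hi : p i = none
  · exact Or.inl hi
  · rw [hy i (mem_stableSet.2 hi)]; exact h i

theorem PrimePoint.isize_le_ccAt {f : (ι → Bool) → Bool} {b : Bool} {p : ι → K}
    (hp : PrimePoint f b p) : isize p ≤ ccAt (hfExt f) p := by
  obtain ⟨S, hS, hcert⟩ := exists_certificate_card_eq_ccAt (hfExt f) p
  rw [isize_eq_card_stableSet, ← hS]
  refine Finset.card_le_card fun i hi => ?_
  by_contra hiS
  refine hp.2 (fun j => if j ∈ S then p j else none) ⟨fun j => ?_, fun he => ?_⟩ ?_
  · by_cases hj : j ∈ S <;> simp [hj]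
  · exact mem_stableSet.1 hi (by simpa [hiS] using (congrFun he i).symm)
  · rw [← hp.1]
    exact hcert _ fun j hj => if_pos hj

theorem ccVal_hfExt_some {f : (ι → Bool) → Bool} {b : Bool} {k : ℕ}
    (h : IsGreatest {s : ℕ | ∃ p : ι → K, PrimePoint f b p ∧ isize p = s} k) :
    ccVal (hfExt f) (some b) = k := by
  obtain ⟨⟨p, hp, hpk⟩, hub⟩ := h
  have hle : ∀ x : {x : ι → K // hfExt f x = some b}, ccAt (hfExt f) x.1 ≤ k := fun x => by
    obtain ⟨q, hq, hqx⟩ := exists_primePoint_below x.2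
    exact (ccAt_le_isize_of_below hq.1 hqx).trans (hub ⟨q, hq, rfl⟩)
  have : Nonempty {x : ι → K // hfExt f x = some b} := ⟨⟨p, hp.1⟩⟩
  refine le_antisymm (ciSup_le hle) ?_
  rw [← hpk]
  exact hp.isize_le_ccAt.trans
    (le_ciSup (f := fun x : {x : ι → K // hfExt f x = some b} => ccAt (hfExt f) x.1)
      ⟨k, Set.forall_mem_range.2 hle⟩ ⟨p, hp.1⟩)

theorem exists_mem_stableSet_inter {f : (ι → Bool) → Bool} {b c : Bool} (hbc : b ≠ c)
    {p q : ι → K} (hp : hfExt f p = some b) (hq : hfExt f q = some c) :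
    (stableSet p ∩ stableSet q).Nonempty := by
  by_contra hemp
  rw [hfExt_eq_some_iff] at hp hq
  have hpq : ∀ i, p i = none ∨ q i = none := fun i => by
    by_contra h
    push Not at h
    exact hemp ⟨i, Finset.mem_inter.2 ⟨mem_stableSet.2 h.1, mem_stableSet.2 h.2⟩⟩
  let z : ι → Bool := fun i => ((p i).or (q i)).getD false
  refine hbc ((hp z fun i => ?_).symm.trans (hq z fun i => ?_))
  · cases h : p i <;> simp [z, h]
  · rcases hpq i with h | h
    · cases h' : q i <;> simp [z, h, h']
    · exact Or.inl h

/-- A point that agrees on the stable coordinates of an implicant `p` with a point having a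
resolution inside the subcube of `p` has such a resolution as well. -/
theorem exists_resolves_of_agree {f : (ι → Bool) → Bool} {b : Bool} {p x y : ι → K}
    (hp : hfExt f p = some b) {z : ι → Bool} (hxz : Resolves x z) (hpz : Resolves p z)
    (hy : ∀ i ∈ stableSet p, y i = x i) : ∃ w, Resolves y w ∧ f w = b := by
  rw [hfExt_eq_some_iff] at hp
  refine ⟨fun i => if p i = none then (y i).getD false else z i, fun i => ?_, hp _ fun i => ?_⟩
  · by_cases hi : p i = none
    · cases h : y i <;> simp [hi, h]
    · simpa [hi, hy i (mem_stableSet.2 hi)] using hxz i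
  · by_cases hi : p i = none
    · exact Or.inl hi
    · simpa [hi] using hpz i

theorem exists_primePoint_resolves {f : (ι → Bool) → Bool} {b : Bool} {z : ι → Bool}
    (hz : f z = b) : ∃ p, PrimePoint f b p ∧ Resolves p z := by
  have : hfExt f (fun i => some (z i)) = some b := by
    rw [hfExt_eq_some_iff]
    intro w hw
    rwa [show w = z from funext fun i => by simpa [eq_comm] using hw i]
  exact exists_primePoint_below this

theorem ccVal_hfExt_none_le {f : (ι → Bool) → Bool} {k₁ k₂ : ℕ}
    (h₁ : ∀ p, PrimePoint f true p → isize p ≤ k₁)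
    (h₂ : ∀ p, PrimePoint f false p → isize p ≤ k₂) :
    ccVal (hfExt f) none ≤ k₁ + k₂ - 1 := by
  refine ciSup_le' fun ⟨x, hx⟩ => ?_
  have hx' := (hfExt_eq_none_iff f x).1 hx
  obtain ⟨z₁, hxz₁, hz₁⟩ := hx' true
  obtain ⟨z₂, hxz₂, hz₂⟩ := hx' false
  obtain ⟨p, hp, hpz⟩ := exists_primePoint_resolves hz₁
  obtain ⟨q, hq, hqz⟩ := exists_primePoint_resolves hz₂
  have hcert : ccAt (hfExt f) x ≤ (stableSet p ∪ stableSet q).card := by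
    refine ccAt_le_card fun y hy => ?_
    rw [hx, hfExt_eq_none_iff]
    rintro (_ | _)
    · exact exists_resolves_of_agree hq.1 hxz₂ hqz fun i hi => hy i (Finset.mem_union_right _ hi)
    · exact exists_resolves_of_agree hp.1 hxz₁ hpz fun i hi => hy i (Finset.mem_union_left _ hi)
  have hpos := (exists_mem_stableSet_inter (by decide) hp.1 hq.1).card_pos
  have hcard := Finset.card_union_add_card_inter (stableSet p) (stableSet q)
  have hp' := h₁ p hp
  have hq' := h₂ q hq
  rw [isize_eq_card_stableSet] at hp' hq'
  dsimp only
  omega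

/-- `cc_u^{(1)}(f̃) = k₁`, `cc_u^{(0)}(f̃) = k₂`, and
`cc_u^{(u)}(f̃) ≤ k₁ + k₂ − 1`, where `k₁` (resp. `k₂`) is the largest size of a prime
implicant (resp. prime implicate) of `f`. -/
theorem cc_vs_prime_implicants (n : ℕ) (f : (Fin n → Bool) → Bool)
    (hnc : ∃ x y, f x ≠ f y) (k1 k2 : ℕ)
    (h1 : IsGreatest {s : ℕ | ∃ p : Fin n → K, PrimeImplicant f p ∧ isize p = s} k1)
    (h2 : IsGreatest {s : ℕ | ∃ p : Fin n → K, PrimeImplicate f p ∧ isize p = s} k2) :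
    ccVal (hfExt f) (some true) = k1 ∧ ccVal (hfExt f) (some false) = k2 ∧
      ccVal (hfExt f) none ≤ k1 + k2 - 1 := by
  exact ⟨ccVal_hfExt_some h1, ccVal_hfExt_some h2,
    ccVal_hfExt_none_le (fun p hp => h1.2 ⟨p, hp, rfl⟩) fun p hp => h2.2 ⟨p, hp, rfl⟩⟩

end HF
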